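/- For every number field k there exists a constant C such that for all real x ≥ 2 the set of squarefree nonzero ideals 𝔡 of 𝓞_k with Φ(𝔡) ≤ x is finite and has cardinality at most C·x. -/

import Mathlib

open NumberField

/-- The multiplicative function `Φ(𝔞) = |𝔞|·∏_{𝔭 ∣ 𝔞}(1 − 1/|𝔭|)`, product over the distinct
prime ideal divisors of `𝔞`. -/
noncomputable def Phi {k : Type*} [Field k] [NumberField k] (a : Ideal (𝓞 k)) : ℝ :=
  (Ideal.absNorm a : ℝ) *
    ∏ᶠ P ∈ {P : Ideal (𝓞 k) | P ≠ ⊥ ∧ P.IsPrime ∧ P ∣ a}, (1 - 1 / (Ideal.absNorm P : ℝ))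

open UniqueFactorizationMonoid

/-- Dyadic partial summation: a linear bound for the partial sums of `w` ordered by `N` bounds the
tail of `∑ w / N ^ 2`. -/
lemma sum_div_sq_le_of_sum_le {ι : Type*} (S : Finset ι) (N w : ι → ℝ) (C : ℝ)
    (h : ∀ y, 0 < y → ∑ i ∈ S with N i ≤ y, w i ≤ C * y)
    (hw : ∀ i, 0 ≤ w i) {x : ℝ} (hx : 0 < x) :
    ∑ i ∈ S with x < N i, w i / N i ^ 2 ≤ 4 * C / x := by
  have hC : 0 ≤ C := by
    simpa using (Finset.sum_nonneg fun i _ ↦ hw i).trans (h 1 one_pos)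
  have key (j : ℕ) : ∑ i ∈ S with x < N i ∧ N i ≤ 2 ^ j * x, w i / N i ^ 2 ≤
      4 * C / x * (1 - (1 / 2) ^ j) := by
    induction j with
    | zero =>
      rw [Finset.filter_false_of_mem]
      · simp
      · intro i _
        simp
    | succ j ih =>
      have hy : 0 < 2 ^ j * x := by positivity
      calc ∑ i ∈ S with x < N i ∧ N i ≤ 2 ^ (j + 1) * x, w i / N i ^ 2
          = ∑ i ∈ S with (x < N i ∧ N i ≤ 2 ^ (j + 1) * x) ∧ N i ≤ 2 ^ j * x, w i / N i ^ 2
            + ∑ i ∈ S with (x < N i ∧ N i ≤ 2 ^ (j + 1) * x) ∧ ¬ N i ≤ 2 ^ j * x,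
                w i / N i ^ 2 := by
            rw [← Finset.sum_filter_add_sum_filter_not {i ∈ S | x < N i ∧ N i ≤ 2 ^ (j + 1) * x}
              (fun i ↦ N i ≤ 2 ^ j * x), Finset.filter_filter, Finset.filter_filter]
        _ ≤ 4 * C / x * (1 - (1 / 2) ^ j) + C * (2 ^ (j + 1) * x) / (2 ^ j * x) ^ 2 := by
            refine add_le_add (le_trans ?_ ih) ?_
            · refine Finset.sum_le_sum_of_subset_of_nonneg ?_ fun i _ _ ↦
                div_nonneg (hw i) (sq_nonneg _)
              intro i
              simp only [Finset.mem_filter]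
              tauto
            · refine le_trans ?_ (div_le_div_of_nonneg_right (h (2 ^ (j + 1) * x) (by positivity))
                (sq_nonneg _))
              rw [Finset.sum_div]
              refine (Finset.sum_le_sum fun i hi ↦ ?_).trans
                (Finset.sum_le_sum_of_subset_of_nonneg (f := fun i ↦ w i / (2 ^ j * x) ^ 2) ?_
                  fun i _ _ ↦ div_nonneg (hw i) (sq_nonneg _))
              · simp only [Finset.mem_filter, not_le] at hi
                have := hw i
                gcongr
                exact hi.2.2.le
              · intro i
                simp only [Finset.mem_filter]
                tauto
        _ = 4 * C / x * (1 - (1 / 2) ^ (j + 1)) := by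
            simp only [pow_succ, one_div, inv_pow]
            field_simp
            ring
  obtain ⟨B, hB⟩ : ∃ B, ∀ i ∈ S, N i ≤ B := by
    obtain ⟨B, hB⟩ := (S.image N).bddAbove
    exact ⟨B, fun i hi ↦ hB (by simpa using ⟨i, hi, rfl⟩)⟩
  obtain ⟨j, hj⟩ := pow_unbounded_of_one_lt (B / x) (one_lt_two (α := ℝ))
  have hS : {i ∈ S | x < N i} = {i ∈ S | x < N i ∧ N i ≤ 2 ^ j * x} := by
    refine Finset.filter_congr fun i hi ↦ ⟨fun h ↦ ⟨h, (hB i hi).trans ?_⟩, And.left⟩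
    exact ((div_lt_iff₀ hx).1 hj).le
  rw [hS]
  refine (key j).trans (mul_le_of_le_one_right (by positivity) ?_)
  have : (0 : ℝ) ≤ (1 / 2) ^ j := by positivity
  linarith

section

variable (k : Type*) [Field k] [NumberField k]

/-- The number of nonzero ideals of norm at most `y` is `O_k(y)`. -/
lemma exists_card_le_mul_of_absNorm_le :
    ∃ C : ℝ, 0 ≤ C ∧ ∀ (D : Finset (Ideal (𝓞 k))) (y : ℝ), 0 ≤ y →
      (∀ I ∈ D, I ≠ ⊥ ∧ (Ideal.absNorm I : ℝ) ≤ y) → (D.card : ℝ) ≤ C * y := by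
  have hfin (y : ℝ) : {I : Ideal (𝓞 k) | (Ideal.absNorm I : ℝ) ≤ y}.Finite := by
    refine (Ideal.finite_setOfPred_absNorm_le (S := 𝓞 k) ⌊y⌋₊).subset fun I hI ↦ ?_
    exact Nat.le_floor hI
  have hcard {D : Finset (Ideal (𝓞 k))} {y : ℝ}
      (hD : ∀ I ∈ D, (Ideal.absNorm I : ℝ) ≤ y) :
      D.card ≤ Nat.card {I : Ideal (𝓞 k) // (Ideal.absNorm I : ℝ) ≤ y} := by
    rw [← Set.ncard_coe_finset]
    exact Set.ncard_le_ncard (t := {I : Ideal (𝓞 k) | (Ideal.absNorm I : ℝ) ≤ y}) hD (hfin y)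
  have ht := NumberField.Ideal.tendsto_norm_le_div_atTop k
  obtain ⟨s, hs⟩ := Filter.eventually_atTop.1 (ht.eventually_le_const (lt_add_one _))
  set L := _ + (1 : ℝ)
  set M := Nat.card {I : Ideal (𝓞 k) // (Ideal.absNorm I : ℝ) ≤ s}
  refine ⟨max L M, le_max_of_le_right M.cast_nonneg, fun D y hy hD ↦ ?_⟩
  rcases D.eq_empty_or_nonempty with rfl | ⟨I, hI⟩
  · simpa using mul_nonneg (le_max_of_le_right M.cast_nonneg) hy
  have hy1 : 1 ≤ y := by
    refine le_trans ?_ (hD I hI).2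
    exact_mod_cast Nat.one_le_iff_ne_zero.2 (Ideal.absNorm_eq_zero_iff.not.2 (hD I hI).1)
  rcases le_total s y with h | h
  · have h1 := hs y h
    rw [div_le_iff₀ (by linarith)] at h1
    calc (D.card : ℝ) ≤ _ := Nat.cast_le.2 (hcard fun I hI ↦ (hD I hI).2)
      _ ≤ _ := h1
      _ ≤ max L M * y := by gcongr; exact le_max_left _ _
  · calc (D.card : ℝ) ≤ M := Nat.cast_le.2 (hcard fun I hI ↦ (hD I hI).2.trans h)
      _ ≤ max L M := le_max_right _ _
      _ ≤ max L M * y := le_mul_of_one_le_right (le_max_of_le_right M.cast_nonneg) hy1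

variable {k}

lemma two_le_absNorm_of_prime {P : Ideal (𝓞 k)} (hP : Prime P) :
    (2 : ℝ) ≤ Ideal.absNorm P := by
  have h0 : Ideal.absNorm P ≠ 0 := Ideal.absNorm_eq_zero_iff.not.2 hP.ne_zero
  have h1 : Ideal.absNorm P ≠ 1 := fun h ↦
    hP.not_isUnit (by simpa [Ideal.isUnit_iff] using Ideal.absNorm_eq_one_iff.1 h)
  exact_mod_cast (by lia : 2 ≤ Ideal.absNorm P)

lemma Phi_eq_prod_primeFactors {a : Ideal (𝓞 k)} (ha : a ≠ ⊥) :
    Phi a = Ideal.absNorm a * ∏ P ∈ primeFactors a, (1 - 1 / (Ideal.absNorm P : ℝ)) := by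
  rw [Phi, ← finprod_mem_coe_finset]
  congr! 4 with P
  rw [Finset.mem_coe, mem_primeFactors, mem_normalizedFactors_iff ha]
  exact ⟨fun ⟨h0, h, hd⟩ ↦ ⟨Ideal.prime_of_isPrime h0 h, hd⟩,
    fun ⟨h, hd⟩ ↦ ⟨h.ne_zero, Ideal.isPrime_of_prime h, hd⟩⟩

variable (k) in
lemma exists_sum_prime_inv_sq_le :
    ∃ K : ℝ, ∀ T : Finset (Ideal (𝓞 k)), (∀ P ∈ T, Prime P) →
      ∑ P ∈ T, 1 / (Ideal.absNorm P : ℝ) ^ 2 ≤ K := by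
  obtain ⟨C, hC, h⟩ := exists_card_le_mul_of_absNorm_le k
  refine ⟨4 * C / 1, fun T hT ↦ ?_⟩
  have := sum_div_sq_le_of_sum_le T (fun P ↦ (Ideal.absNorm P : ℝ)) 1 C (fun y hy ↦ ?_)
    (fun _ ↦ zero_le_one) one_pos
  · rwa [Finset.filter_true_of_mem fun P hP ↦ ?_] at this
    linarith [two_le_absNorm_of_prime (hT P hP)]
  · simpa using h {P ∈ T | (Ideal.absNorm P : ℝ) ≤ y} y hy.le fun P hP ↦ by
      simp only [Finset.mem_filter] at hP
      exact ⟨(hT P hP.1).ne_zero, hP.2⟩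

/-- The value at a prime of norm `q` of the Möbius transform of the multiplicative function
`(|𝔞| / Φ(𝔞)) ^ 2`. -/
noncomputable def sqRatioCoeff (q : ℝ) : ℝ := ((1 - 1 / q) ^ 2)⁻¹ - 1

lemma sqRatioCoeff_nonneg {q : ℝ} (hq : 2 ≤ q) : 0 ≤ sqRatioCoeff q := by
  have h1 : 1 / q ≤ 1 / 2 := one_div_le_one_div_of_le two_pos hq
  have h0 : 0 < 1 / q := by positivity
  have : 1 ≤ ((1 - 1 / q) ^ 2)⁻¹ := (one_le_inv₀ (by nlinarith)).2 (by nlinarith)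
  rw [sqRatioCoeff]
  linarith

lemma sqRatioCoeff_le {q : ℝ} (hq : 2 ≤ q) : sqRatioCoeff q ≤ 8 / q := by
  have h0 : 0 < q := by linarith
  have h1 : 0 < q - 1 := by linarith
  have h : sqRatioCoeff q = (2 * q - 1) / (q - 1) ^ 2 := by
    rw [sqRatioCoeff, one_sub_div h0.ne']
    field_simp
    ring
  rw [h, div_le_div_iff₀ (by positivity) h0]
  nlinarith

lemma prime_of_mem_primeFactors {a P : Ideal (𝓞 k)} (hP : P ∈ primeFactors a) : Prime P :=
  prime_of_normalized_factor P (mem_primeFactors.1 hP)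

lemma Phi_nonneg {a : Ideal (𝓞 k)} (ha : a ≠ ⊥) : 0 ≤ Phi a := by
  rw [Phi_eq_prod_primeFactors ha]
  refine mul_nonneg (Nat.cast_nonneg _) (Finset.prod_nonneg fun P hP ↦ ?_)
  have := two_le_absNorm_of_prime (prime_of_mem_primeFactors hP)
  rw [sub_nonneg, div_le_one (by linarith)]
  linarith

/-- `(|𝔞| / Φ(𝔞)) ^ 2` as a product over primes. -/
noncomputable def sqRatio (a : Ideal (𝓞 k)) : ℝ :=
  ∏ P ∈ primeFactors a, (1 + sqRatioCoeff (Ideal.absNorm P))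

lemma sqRatio_nonneg (a : Ideal (𝓞 k)) : 0 ≤ sqRatio a :=
  Finset.prod_nonneg fun _ hP ↦ add_nonneg zero_le_one <|
    sqRatioCoeff_nonneg (two_le_absNorm_of_prime (prime_of_mem_primeFactors hP))

lemma sqRatio_mul_Phi_sq {a : Ideal (𝓞 k)} (ha : a ≠ ⊥) :
    sqRatio a * Phi a ^ 2 = (Ideal.absNorm a : ℝ) ^ 2 := by
  rw [Phi_eq_prod_primeFactors ha, sqRatio, mul_pow, mul_left_comm, ← Finset.prod_pow,
    ← Finset.prod_mul_distrib, Finset.prod_eq_one, mul_one]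
  intro P hP
  have := two_le_absNorm_of_prime (prime_of_mem_primeFactors hP)
  have h : (Ideal.absNorm P : ℝ) - 1 ≠ 0 := by linarith
  rw [sqRatioCoeff, one_sub_div (by linarith)]
  field_simp
  ring

lemma prod_dvd_of_subset_primeFactors {a : Ideal (𝓞 k)} {T : Finset (Ideal (𝓞 k))}
    (hT : T ⊆ primeFactors a) : ∏ P ∈ T, P ∣ a :=
  Finset.prod_primes_dvd a (fun _ hP ↦ prime_of_mem_primeFactors (hT hP))
    fun _ hP ↦ dvd_of_mem_normalizedFactors (mem_primeFactors.1 (hT hP))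

variable (k) in
lemma exists_card_dvd_le :
    ∃ C : ℝ, 0 ≤ C ∧ ∀ (D : Finset (Ideal (𝓞 k))) (y : ℝ), 0 ≤ y → ∀ J : Ideal (𝓞 k), J ≠ ⊥ →
      (∀ I ∈ D, I ≠ ⊥ ∧ (Ideal.absNorm I : ℝ) ≤ y ∧ J ∣ I) →
      (D.card : ℝ) ≤ C * (y / Ideal.absNorm J) := by
  classical
  obtain ⟨C, hC, h⟩ := exists_card_le_mul_of_absNorm_le k
  refine ⟨C, hC, fun D y hy J hJ hD ↦ ?_⟩
  have hJ0 : (0 : ℝ) < Ideal.absNorm J := by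
    exact_mod_cast Nat.pos_of_ne_zero (Ideal.absNorm_eq_zero_iff.not.2 hJ)
  choose! g hg using fun I hI ↦ (hD I hI).2.2
  have hinj : Set.InjOn g D := fun I hI I' hI' hII ↦ by rw [hg I hI, hg I' hI', hII]
  rw [← Finset.card_image_of_injOn hinj]
  refine h _ _ (by positivity) fun M hM ↦ ?_
  obtain ⟨I, hI, rfl⟩ := Finset.mem_image.1 hM
  obtain ⟨hI0, hIy, -⟩ := hD I hI
  refine ⟨fun h0 ↦ hI0 ?_, ?_⟩
  · rw [hg I hI, h0, Ideal.mul_bot]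
  · rw [le_div_iff₀ hJ0]
    rw [hg I hI, map_mul, Nat.cast_mul] at hIy
    linarith

variable (k) in
lemma exists_sum_sqRatio_le :
    ∃ C : ℝ, ∀ (D : Finset (Ideal (𝓞 k))) (y : ℝ), 0 ≤ y →
      (∀ I ∈ D, I ≠ ⊥ ∧ (Ideal.absNorm I : ℝ) ≤ y) → ∑ I ∈ D, sqRatio I ≤ C * y := by
  classical
  obtain ⟨C, hC, hcard⟩ := exists_card_dvd_le k
  obtain ⟨K, hK⟩ := exists_sum_prime_inv_sq_le k
  refine ⟨C * Real.exp (8 * K), fun D y hy hD ↦ ?_⟩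
  set U := D.biUnion primeFactors
  have hU : ∀ P ∈ U, Prime P := fun P hP ↦ by
    obtain ⟨I, -, hI⟩ := Finset.mem_biUnion.1 hP
    exact prime_of_mem_primeFactors hI
  have hN : ∀ P ∈ U, (2 : ℝ) ≤ Ideal.absNorm P := fun P hP ↦ two_le_absNorm_of_prime (hU P hP)
  calc ∑ I ∈ D, sqRatio I
      = ∑ I ∈ D, ∑ T ∈ (primeFactors I).powerset, ∏ P ∈ T, sqRatioCoeff (Ideal.absNorm P) := by
        simp only [sqRatio, Finset.prod_one_add]
    _ = ∑ T ∈ U.powerset, ∑ I ∈ D with T ⊆ primeFactors I,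
          ∏ P ∈ T, sqRatioCoeff (Ideal.absNorm P) := by
        refine Finset.sum_comm' fun I T ↦ ?_
        simp only [Finset.mem_powerset, Finset.mem_filter]
        exact ⟨fun h ↦ ⟨h, h.2.trans (Finset.subset_biUnion_of_mem _ h.1)⟩, And.left⟩
    _ ≤ ∑ T ∈ U.powerset,
          C * y * ∏ P ∈ T, (sqRatioCoeff (Ideal.absNorm P) / Ideal.absNorm P) := by
        refine Finset.sum_le_sum fun T hT ↦ ?_
        have hTU := Finset.mem_powerset.1 hT
        have hprod : 0 ≤ ∏ P ∈ T, sqRatioCoeff (Ideal.absNorm P) :=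
          Finset.prod_nonneg fun P hP ↦ sqRatioCoeff_nonneg (hN P (hTU hP))
        have := hcard {I ∈ D | T ⊆ primeFactors I} y hy (∏ P ∈ T, P)
          (Finset.prod_ne_zero_iff.2 fun P hP ↦ (hU P (hTU hP)).ne_zero) fun I hI ↦ by
            obtain ⟨hI, hTI⟩ := Finset.mem_filter.1 hI
            exact ⟨(hD I hI).1, (hD I hI).2, prod_dvd_of_subset_primeFactors hTI⟩
        rw [map_prod, Nat.cast_prod] at this
        rw [Finset.sum_const, nsmul_eq_mul, Finset.prod_div_distrib]
        refine (mul_le_mul_of_nonneg_right this hprod).trans_eq ?_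
        ring
    _ = C * y * ∏ P ∈ U, (1 + sqRatioCoeff (Ideal.absNorm P) / Ideal.absNorm P) := by
        rw [← Finset.mul_sum, Finset.prod_one_add]
    _ ≤ C * y * ∏ P ∈ U, (1 + 8 * (1 / (Ideal.absNorm P : ℝ) ^ 2)) := by
        refine mul_le_mul_of_nonneg_left (Finset.prod_le_prod (fun P hP ↦ ?_) fun P hP ↦
          add_le_add_right ?_ 1) (by positivity)
        · have := sqRatioCoeff_nonneg (hN P hP)
          positivity
        · refine (div_le_div_of_nonneg_right (sqRatioCoeff_le (hN P hP))
            (Nat.cast_nonneg _)).trans_eq ?_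
          rw [div_div, ← sq, mul_one_div]
    _ ≤ C * y * Real.exp (∑ P ∈ U, 8 * (1 / (Ideal.absNorm P : ℝ) ^ 2)) := by
        gcongr
        exact Real.prod_one_add_le_exp_sum _ fun _ ↦ by positivity
    _ ≤ C * y * Real.exp (8 * K) := by
        rw [← Finset.mul_sum]
        gcongr
        exact hK U hU
    _ = C * Real.exp (8 * K) * y := by ring

variable (k) in
lemma exists_card_le_mul_of_Phi_le :
    ∃ C : ℝ, ∀ (D : Finset (Ideal (𝓞 k))) (x : ℝ), 0 < x →
      (∀ I ∈ D, I ≠ ⊥ ∧ Phi I ≤ x) → (D.card : ℝ) ≤ C * x := by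
  obtain ⟨C, -, hC⟩ := exists_card_le_mul_of_absNorm_le k
  obtain ⟨B, hB⟩ := exists_sum_sqRatio_le k
  refine ⟨C + 4 * B, fun D x hx hD ↦ ?_⟩
  have hsmall := hC {I ∈ D | (Ideal.absNorm I : ℝ) ≤ x} x hx.le fun I hI ↦ by
    obtain ⟨hI, hIx⟩ := Finset.mem_filter.1 hI
    exact ⟨(hD I hI).1, hIx⟩
  have htail := sum_div_sq_le_of_sum_le D (fun I ↦ (Ideal.absNorm I : ℝ)) sqRatio B
    (fun y hy ↦ hB _ y hy.le fun I hI ↦ by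
      obtain ⟨hI, hIy⟩ := Finset.mem_filter.1 hI
      exact ⟨(hD I hI).1, hIy⟩) sqRatio_nonneg hx
  have hlarge : (Finset.card {I ∈ D | ¬ (Ideal.absNorm I : ℝ) ≤ x} : ℝ) ≤ 4 * B * x := by
    calc (Finset.card {I ∈ D | ¬ (Ideal.absNorm I : ℝ) ≤ x} : ℝ)
        = ∑ I ∈ D with x < (Ideal.absNorm I : ℝ), 1 := by simp
      _ ≤ ∑ I ∈ D with x < (Ideal.absNorm I : ℝ),
            x ^ 2 * (sqRatio I / (Ideal.absNorm I : ℝ) ^ 2) := by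
          refine Finset.sum_le_sum fun I hI ↦ ?_
          obtain ⟨hI, hIx⟩ := Finset.mem_filter.1 hI
          have hN : (0 : ℝ) < (Ideal.absNorm I : ℝ) ^ 2 := pow_pos (hx.trans hIx) 2
          rw [← mul_div_assoc, one_le_div hN, ← sqRatio_mul_Phi_sq (hD I hI).1, mul_comm]
          exact mul_le_mul_of_nonneg_right
            (pow_le_pow_left₀ (Phi_nonneg (hD I hI).1) (hD I hI).2 2) (sqRatio_nonneg I)
      _ ≤ x ^ 2 * (4 * B / x) := by
          rw [← Finset.mul_sum]
          gcongr
      _ = 4 * B * x := by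
          field_simp
  rw [← Finset.card_filter_add_card_filter_not (s := D) fun I ↦ (Ideal.absNorm I : ℝ) ≤ x,
    Nat.cast_add, add_mul]
  exact add_le_add hsmall hlarge

end

/-- For every number field `k`, the number of squarefree ideals `𝔡` of `𝓞 k` with `Φ(𝔡) ≤ x`
is finite and `O_k(x)`. -/
theorem stmt_14 (k : Type*) [Field k] [NumberField k] :
    ∃ C : ℝ, ∀ x : ℝ, 2 ≤ x →
      {𝔡 : Ideal (𝓞 k) | 𝔡 ≠ ⊥ ∧ Squarefree 𝔡 ∧ Phi 𝔡 ≤ x}.Finite ∧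
      ({𝔡 : Ideal (𝓞 k) | 𝔡 ≠ ⊥ ∧ Squarefree 𝔡 ∧ Phi 𝔡 ≤ x}.ncard : ℝ) ≤ C * x := by
  obtain ⟨C, hC⟩ := exists_card_le_mul_of_Phi_le k
  refine ⟨C, fun x hx ↦ ?_⟩
  set S := {𝔡 : Ideal (𝓞 k) | 𝔡 ≠ ⊥ ∧ Squarefree 𝔡 ∧ Phi 𝔡 ≤ x}
  have hcard (D : Finset (Ideal (𝓞 k))) (hD : (D : Set (Ideal (𝓞 k))) ⊆ S) :
      (D.card : ℝ) ≤ C * x :=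
    hC D x (by linarith) fun I hI ↦ ⟨(hD hI).1, (hD hI).2.2⟩
  have hfin : S.Finite := by
    by_contra h
    obtain ⟨D, hDS, hDc⟩ := Set.Infinite.exists_subset_card_eq h (⌊C * x⌋₊ + 1)
    have := hcard D hDS
    rw [hDc, Nat.cast_add, Nat.cast_one] at this
    exact (Nat.lt_floor_add_one (C * x)).not_ge this
  refine ⟨hfin, ?_⟩
  rw [Set.ncard_eq_toFinset_card S hfin]
  exact hcard _ (by simp)
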